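/- arXiv:solv-int/9701005 — 2 statements merged into one kernel-verified Lean document; each statement's English description precedes it below -/
import Mathlib

section
/- In the even Wronskian setup with n = 2k, suppose that for j = 0, …, k−1 there are smooth real-valued functions f_j : ℝ² → ℝ with θ_{2j} = (f_j, 0) (the even superfield f_j, regarding ℝ ⊂ Λ₀) and θ_{2j+1} = (0, f_j) (i.e. θ_{2j+1} = ϑ θ_{2j}). If smooth real-valued functions A₀, …, A_{k−1} : ℝ² → ℝ satisfy Σ_{m=0}^{k−1} A_m ∂ₓ^m f_j = −∂ₓ^k f_j for every j = 0, …, k−1, then the superfields a_{2m} := (A_m, 0) and a_{2m+1} := 0 (m = 0, …, k−1) solve the kernel system: ∂^k θ_j + Σ_{i=0}^{2k−1} a_i D^i θ_j = 0 for all j = 0, …, 2k−1. -/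
noncomputable section
open scoped BigOperators

/-- The exterior algebra `Λ` of `ℝ^N`. -/
abbrev SuperAlg (N : ℕ) : Type := ExteriorAlgebra ℝ (Fin N → ℝ)

/-- The even part `Λ₀` of the exterior algebra. -/
def LambdaEven (N : ℕ) : Submodule ℝ (SuperAlg N) :=
  CliffordAlgebra.evenOdd (0 : QuadraticForm ℝ (Fin N → ℝ)) 0

/-- The odd part `Λ₁` of the exterior algebra. -/
def LambdaOdd (N : ℕ) : Submodule ℝ (SuperAlg N) :=
  CliffordAlgebra.evenOdd (0 : QuadraticForm ℝ (Fin N → ℝ)) 1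

/-- A superfield: a pair `(f₀, f₁)` of maps `ℝ² → Λ`, encoding
`f(x,t,ϑ) = f₀(x,t) + ϑ f₁(x,t)`. -/
@[ext] structure SF (N : ℕ) where
  c0 : ℝ → ℝ → SuperAlg N
  c1 : ℝ → ℝ → SuperAlg N

namespace SF
variable {N : ℕ}

instance : Zero (SF N) := ⟨⟨0, 0⟩⟩
instance : Add (SF N) := ⟨fun f g => ⟨f.c0 + g.c0, f.c1 + g.c1⟩⟩
instance : Neg (SF N) := ⟨fun f => ⟨-f.c0, -f.c1⟩⟩
instance : Sub (SF N) := ⟨fun f g => ⟨f.c0 - g.c0, f.c1 - g.c1⟩⟩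
instance : SMul ℕ (SF N) := ⟨fun n f => ⟨n • f.c0, n • f.c1⟩⟩
instance : SMul ℤ (SF N) := ⟨fun n f => ⟨n • f.c0, n • f.c1⟩⟩
instance : SMul ℝ (SF N) := ⟨fun r f => ⟨r • f.c0, r • f.c1⟩⟩

instance : AddCommGroup (SF N) :=
  Function.Injective.addCommGroup
    (M₂ := (ℝ → ℝ → SuperAlg N) × (ℝ → ℝ → SuperAlg N))
    (fun f => (f.c0, f.c1))
    (fun a b h => by cases a; cases b; simpa using h)
    rfl (fun _ _ => rfl) (fun _ => rfl) (fun _ _ => rfl) (fun _ _ => rfl) (fun _ _ => rfl)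

instance : One (SF N) := ⟨⟨fun _ _ => 1, fun _ _ => 0⟩⟩

/-- The product of superfields: `(fg)₀ = f₀g₀`,
`(fg)₁ = f₁g₀ + σ(f₀)g₁` where `σ` is the grade involution of `Λ`
(this is the bilinear extension of the parity-sign formula for homogeneous factors). -/
instance : Mul (SF N) := ⟨fun f g =>
  ⟨fun x t => f.c0 x t * g.c0 x t,
   fun x t => f.c1 x t * g.c0 x t + CliffordAlgebra.involute (f.c0 x t) * g.c1 x t⟩⟩

/-- An even superfield. -/
def IsEven (f : SF N) : Prop :=
  (∀ x t, f.c0 x t ∈ LambdaEven N) ∧ (∀ x t, f.c1 x t ∈ LambdaOdd N)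

/-- An odd superfield. -/
def IsOdd (f : SF N) : Prop :=
  (∀ x t, f.c0 x t ∈ LambdaOdd N) ∧ (∀ x t, f.c1 x t ∈ LambdaEven N)

/-- A superfield is invertible when `f₀(x,t)` is invertible in `Λ` for all `(x,t)`. -/
def Invertible (f : SF N) : Prop := ∀ x t, IsUnit (f.c0 x t)

/-- The multiplicative inverse of a superfield (junk unless `f` is invertible). -/
def sinv (f : SF N) : SF N :=
  ⟨fun x t => Ring.inverse (f.c0 x t),
   fun x t => -(Ring.inverse (CliffordAlgebra.involute (f.c0 x t)) * f.c1 x t *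
      Ring.inverse (f.c0 x t))⟩

end SF

/-- Derivative of a `Λ`-valued function of one real variable, characterized through all
linear functionals (junk value `0` when not differentiable). -/
def derLam {N : ℕ} (g : ℝ → SuperAlg N) (x : ℝ) : SuperAlg N := by
  classical
  exact if h : ∃ d : SuperAlg N, ∀ l : SuperAlg N →ₗ[ℝ] ℝ,
      HasDerivAt (fun y => l (g y)) (l d) x
    then h.choose else 0

/-- Smoothness of a `Λ`-valued function on `ℝ²`. -/
def SmoothLam {N : ℕ} (g : ℝ → ℝ → SuperAlg N) : Prop :=
  ∀ l : SuperAlg N →ₗ[ℝ] ℝ, ContDiff ℝ (⊤ : ℕ∞) (fun p : ℝ × ℝ => l (g p.1 p.2))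

namespace SF
variable {N : ℕ}

/-- A superfield is smooth when both components are. -/
def Smooth (f : SF N) : Prop := SmoothLam f.c0 ∧ SmoothLam f.c1

/-- `∂f`, the `x`-derivative. -/
def dx (f : SF N) : SF N :=
  ⟨fun x t => derLam (fun y => f.c0 y t) x, fun x t => derLam (fun y => f.c1 y t) x⟩

/-- `∂ₜf`, the `t`-derivative. -/
def dt (f : SF N) : SF N :=
  ⟨fun x t => derLam (fun s => f.c0 x s) t, fun x t => derLam (fun s => f.c1 x s) t⟩

/-- The odd superderivative `D`, with `Df = (f₁, ∂ₓf₀)`, so `D ∘ D = ∂`. -/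
def Dsd (f : SF N) : SF N := ⟨f.c1, fun x t => derLam (fun y => f.c0 y t) x⟩

end SF

/-- `D^n`. -/
def Dpow {N : ℕ} : ℕ → SF N → SF N
  | 0, f => f
  | m + 1, f => (Dpow m f).Dsd

/-- `∂^n`. -/
def Xpow {N : ℕ} : ℕ → SF N → SF N
  | 0, f => f
  | m + 1, f => (Xpow m f).dx

/-- `f` has the parity `(−1)^m`. -/
def parityAt {N : ℕ} (f : SF N) (m : ℕ) : Prop :=
  if m % 2 = 0 then f.IsEven else f.IsOdd

/-- The Manin–Radul supersymmetric KdV system. -/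
def MRSKdV {N : ℕ} (α u : SF N) : Prop :=
  α.dt = (1/4 : ℝ) • (α.dx.dx + (3:ℝ) • (α * α.Dsd) + (6:ℝ) • (α * u)).dx ∧
  u.dt = (1/4 : ℝ) • (u.dx.dx + (3:ℝ) • (u * u) + (3:ℝ) • (α * u.Dsd)).dx

/-- The Lax operator `L = ∂² + αD + u`. -/
def Lop {N : ℕ} (α u ψ : SF N) : SF N := ψ.dx.dx + α * ψ.Dsd + u * ψ

/-- The operator `M = (1/2)α∂D + λ∂ + (1/2)u∂ − (1/4)(∂α)D − (1/4)(∂u)`. -/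
def Mop {N : ℕ} (α u : SF N) (lam : ℝ) (ψ : SF N) : SF N :=
  (1/2 : ℝ) • (α * ψ.Dsd.dx) + lam • ψ.dx + (1/2 : ℝ) • (u * ψ.dx)
    - (1/4 : ℝ) • (α.dx * ψ.Dsd) - (1/4 : ℝ) • (u.dx * ψ)

/-- The linear system `Lψ = λψ`, `∂ₜψ = Mψ` associated with `(α,u)` at `λ`. -/
def LinSys {N : ℕ} (α u : SF N) (lam : ℝ) (ψ : SF N) : Prop :=
  Lop α u ψ = lam • ψ ∧ ψ.dt = Mop α u lam ψ

/-- `δ₀ = −(Dθ₀)θ₀⁻¹`. -/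
def delta0 {N : ℕ} (θ : SF N) : SF N := -(θ.Dsd * θ.sinv)

/-- The Darboux-transformed `α̂ = −α − 2∂δ₀`. -/
def hatAlpha {N : ℕ} (α θ : SF N) : SF N := -α - (2:ℝ) • (delta0 θ).dx

/-- The Darboux-transformed `û = u + Dα + 2δ₀(α + ∂δ₀)`. -/
def hatU {N : ℕ} (α u θ : SF N) : SF N :=
  u + α.Dsd + (2:ℝ) • (delta0 θ * (α + (delta0 θ).dx))

/-- `darbIter θ m j = θ_j[m]`, the `j`-th seed after `m` Darboux steps. -/
def darbIter {N : ℕ} (θ : ℕ → SF N) : ℕ → ℕ → SF N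
  | 0, j => θ j
  | m + 1, j => (darbIter θ m j).Dsd + delta0 (darbIter θ m m) * darbIter θ m j

/-- `Titer θ n ψ = T_n ψ = (D+δ_{n−1})⋯(D+δ₀)ψ`. -/
def Titer {N : ℕ} (θ : ℕ → SF N) : ℕ → SF N → SF N
  | 0, ψ => ψ
  | m + 1, ψ => (Titer θ m ψ).Dsd + delta0 (darbIter θ m m) * Titer θ m ψ

/-- Determinant of a matrix of superfields: Leibniz formula with rows in
ascending order (for matrices of commuting, e.g. even, entries this is the usual
determinant, and when exactly one row is odd it agrees with the Laplace
expansion along that row). -/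
def detSF {N k : ℕ} (M : Matrix (Fin k) (Fin k) (SF N)) : SF N :=
  ∑ σ : Equiv.Perm (Fin k),
    ((Equiv.Perm.sign σ : ℤ)) • (((List.finRange k).map fun i => M i (σ i)).prod)

/-- Entrywise `D`-derivative of a matrix of superfields. -/
def DmatSF {N m n : ℕ} (M : Matrix (Fin m) (Fin n) (SF N)) : Matrix (Fin m) (Fin n) (SF N) :=
  Matrix.of fun i j => (M i j).Dsd

/-- The embedding `Fin (k−1) → Fin k` skipping `j`. -/
def dropIdx {k : ℕ} (j : Fin k) (i : Fin (k - 1)) : Fin k :=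
  ⟨if i.1 < j.1 then i.1 else i.1 + 1, by
    have h1 := i.2; have h2 := j.2; split <;> omega⟩

/-- The minor of `M` obtained by deleting row `j` and column `i`. -/
def minorSF {N k : ℕ} (M : Matrix (Fin k) (Fin k) (SF N)) (j i : Fin k) :
    Matrix (Fin (k-1)) (Fin (k-1)) (SF N) :=
  M.submatrix (dropIdx j) (dropIdx i)

/-- Adjugate matrix (matrix of cofactors, transposed). -/
def adjSF {N k : ℕ} (M : Matrix (Fin k) (Fin k) (SF N)) : Matrix (Fin k) (Fin k) (SF N) :=
  Matrix.of fun i j => ((-1 : ℤ) ^ (i.1 + j.1)) • detSF (minorSF M j i)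

/-- Inverse of a matrix of (even) superfields, via the adjugate
(junk unless `detSF M` is invertible). -/
def invSF {N k : ℕ} (M : Matrix (Fin k) (Fin k) (SF N)) : Matrix (Fin k) (Fin k) (SF N) :=
  Matrix.of fun i j => (detSF M).sinv * adjSF M i j

section EvenWronskian

variable {N : ℕ}

/-- `θ^{(0)} = (θ₀, θ₂, …)`. -/
def evenSeq (θ : ℕ → SF N) : ℕ → SF N := fun j => θ (2 * j)

/-- `θ^{(1)} = (θ₁, θ₃, …)`. -/
def oddSeq (θ : ℕ → SF N) : ℕ → SF N := fun j => θ (2 * j + 1)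

/-- The `k×k` Wronski matrix with rows `v, ∂v, …, ∂^{k−1}v`. -/
def Wmat (N : ℕ) (k : ℕ) (v : ℕ → SF N) : Matrix (Fin k) (Fin k) (SF N) :=
  Matrix.of fun i j => Xpow i.1 (v j.1)

/-- The Wronski matrix with last row replaced by `∂^k v`. -/
def WmatHat (N : ℕ) (k : ℕ) (v : ℕ → SF N) : Matrix (Fin k) (Fin k) (SF N) :=
  Matrix.of fun i j => if i.1 = k - 1 then Xpow k (v j.1) else Xpow i.1 (v j.1)

/-- The Wronski matrix with rows `Dv, D∂v, …, D∂^{k−2}v` and last row `∂^k v`. -/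
def WmatBarD (N : ℕ) (k : ℕ) (v : ℕ → SF N) : Matrix (Fin k) (Fin k) (SF N) :=
  Matrix.of fun i j => if i.1 = k - 1 then Xpow k (v j.1) else (Xpow i.1 (v j.1)).Dsd

/-- `W^{(0)}` (even case, `n = 2k`). -/
def W0E (N k : ℕ) (θ : ℕ → SF N) : Matrix (Fin k) (Fin k) (SF N) := Wmat N k (evenSeq θ)

/-- `W^{(1)}` (even case, `n = 2k`). -/
def W1E (N k : ℕ) (θ : ℕ → SF N) : Matrix (Fin k) (Fin k) (SF N) := Wmat N k (oddSeq θ)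

/-- The Schur complement `W^{(0)} − W^{(1)}(DW^{(1)})⁻¹DW^{(0)}`. -/
def SchurE (N k : ℕ) (θ : ℕ → SF N) : Matrix (Fin k) (Fin k) (SF N) :=
  W0E N k θ - W1E N k θ * invSF (DmatSF (W1E N k θ)) * DmatSF (W0E N k θ)

/-- The Schur complement `DW^{(1)} − (DW^{(0)})(W^{(0)})⁻¹W^{(1)}`. -/
def SchurE2 (N k : ℕ) (θ : ℕ → SF N) : Matrix (Fin k) (Fin k) (SF N) :=
  DmatSF (W1E N k θ) - DmatSF (W0E N k θ) * invSF (W0E N k θ) * W1E N k θ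

/-- `sdet 𝒲` (even case). -/
def sdetE (N k : ℕ) (θ : ℕ → SF N) : SF N :=
  detSF (SchurE N k θ) * (detSF (DmatSF (W1E N k θ))).sinv

/-- The Schur complement of the block matrix `𝒲̂` (even case). -/
def SchurEHat (N k : ℕ) (θ : ℕ → SF N) : Matrix (Fin k) (Fin k) (SF N) :=
  WmatHat N k (evenSeq θ) - WmatHat N k (oddSeq θ) * invSF (DmatSF (W1E N k θ)) * DmatSF (W0E N k θ)

/-- `sdet 𝒲̂` (even case). -/
def sdetEHat (N k : ℕ) (θ : ℕ → SF N) : SF N :=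
  detSF (SchurEHat N k θ) * (detSF (DmatSF (W1E N k θ))).sinv

end EvenWronskian

section OddWronskian

/-- `W^{(0)}`, a `(k+1)×(k+1)` matrix (odd case, `n = 2k+1`). -/
def W0O (N k : ℕ) (θ : ℕ → SF N) : Matrix (Fin (k+1)) (Fin (k+1)) (SF N) :=
  Matrix.of fun i j => Xpow i.1 (θ (2 * j.1))

/-- `W^{(1)}`, a `(k+1)×k` matrix (odd case). -/
def W1O (N k : ℕ) (θ : ℕ → SF N) : Matrix (Fin (k+1)) (Fin k) (SF N) :=
  Matrix.of fun i j => Xpow i.1 (θ (2 * j.1 + 1))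

/-- `W̃^{(0)}`: `W^{(0)}` with its last row removed. -/
def Wtil0 (N k : ℕ) (θ : ℕ → SF N) : Matrix (Fin k) (Fin (k+1)) (SF N) :=
  Matrix.of fun i j => Xpow i.1 (θ (2 * j.1))

/-- `W̃^{(1)}`: `W^{(1)}` with its last row removed. -/
def Wtil1 (N k : ℕ) (θ : ℕ → SF N) : Matrix (Fin k) (Fin k) (SF N) :=
  Matrix.of fun i j => Xpow i.1 (θ (2 * j.1 + 1))

/-- `W̌^{(0)}`: `W^{(0)}` with its second-to-last row removed. -/
def Wchk0 (N k : ℕ) (θ : ℕ → SF N) : Matrix (Fin k) (Fin (k+1)) (SF N) :=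
  Matrix.of fun i j => Xpow (if i.1 = k - 1 then k else i.1) (θ (2 * j.1))

/-- `W̌^{(1)}`: `W^{(1)}` with its second-to-last row removed. -/
def Wchk1 (N k : ℕ) (θ : ℕ → SF N) : Matrix (Fin k) (Fin k) (SF N) :=
  Matrix.of fun i j => Xpow (if i.1 = k - 1 then k else i.1) (θ (2 * j.1 + 1))

/-- `Ŵ^{(0)}`: `W^{(0)}` with last row `∂^k θ^{(0)}` replaced by `D∂^k θ^{(0)}`. -/
def W0OHat (N k : ℕ) (θ : ℕ → SF N) : Matrix (Fin (k+1)) (Fin (k+1)) (SF N) :=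
  Matrix.of fun i j => if i.1 = k then Dpow (2*k+1) (θ (2 * j.1)) else Xpow i.1 (θ (2 * j.1))

/-- `Ŵ^{(1)}`: `W^{(1)}` with last row `∂^k θ^{(1)}` replaced by `D∂^k θ^{(1)}`. -/
def W1OHat (N k : ℕ) (θ : ℕ → SF N) : Matrix (Fin (k+1)) (Fin k) (SF N) :=
  Matrix.of fun i j => if i.1 = k then Dpow (2*k+1) (θ (2 * j.1 + 1)) else Xpow i.1 (θ (2 * j.1 + 1))

/-- The Schur complement `W^{(0)} − W^{(1)}(DW̃^{(1)})⁻¹DW̃^{(0)}`. -/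
def SchurO (N k : ℕ) (θ : ℕ → SF N) : Matrix (Fin (k+1)) (Fin (k+1)) (SF N) :=
  W0O N k θ - W1O N k θ * invSF (DmatSF (Wtil1 N k θ)) * DmatSF (Wtil0 N k θ)

/-- The Schur complement `W^{(0)} − W^{(1)}(DW̌^{(1)})⁻¹DW̌^{(0)}`. -/
def SchurOchk (N k : ℕ) (θ : ℕ → SF N) : Matrix (Fin (k+1)) (Fin (k+1)) (SF N) :=
  W0O N k θ - W1O N k θ * invSF (DmatSF (Wchk1 N k θ)) * DmatSF (Wchk0 N k θ)

/-- The Schur complement `Ŵ^{(0)} − Ŵ^{(1)}(DW̃^{(1)})⁻¹DW̃^{(0)}`. -/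
def SchurOHat (N k : ℕ) (θ : ℕ → SF N) : Matrix (Fin (k+1)) (Fin (k+1)) (SF N) :=
  W0OHat N k θ - W1OHat N k θ * invSF (DmatSF (Wtil1 N k θ)) * DmatSF (Wtil0 N k θ)

/-- `sdet 𝒲` (odd case). -/
def sdetO (N k : ℕ) (θ : ℕ → SF N) : SF N :=
  detSF (SchurO N k θ) * (detSF (DmatSF (Wtil1 N k θ))).sinv

/-- `sdet 𝒲̌` (odd case). -/
def sdetOchk (N k : ℕ) (θ : ℕ → SF N) : SF N :=
  detSF (SchurOchk N k θ) * (detSF (DmatSF (Wchk1 N k θ))).sinv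

/-- The quotient `det(Ŵ^{(0)} − Ŵ^{(1)}(DW̃^{(1)})⁻¹DW̃^{(0)}) / det(W^{(0)} − W^{(1)}(DW̃^{(1)})⁻¹DW̃^{(0)})`. -/
def Qodd (N k : ℕ) (θ : ℕ → SF N) : SF N :=
  detSF (SchurOHat N k θ) * (detSF (SchurO N k θ)).sinv

end OddWronskian

/-- The partial derivative in `x` of a real function of `(x,t)`. -/
def pdxR (u : ℝ → ℝ → ℝ) : ℝ → ℝ → ℝ := fun x t => deriv (fun y => u y t) x

theorem derLam_algMap {N : ℕ} (u : ℝ → ℝ) (x : ℝ) (hu : DifferentiableAt ℝ u x) :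
    derLam (fun y => algebraMap ℝ (SuperAlg N) (u y)) x
      = algebraMap ℝ (SuperAlg N) (deriv u x) := by
  have key : ∀ l : SuperAlg N →ₗ[ℝ] ℝ,
      HasDerivAt (fun y => l (algebraMap ℝ (SuperAlg N) (u y)))
        (l (algebraMap ℝ (SuperAlg N) (deriv u x))) x := by
    intro l
    simp only [Algebra.algebraMap_eq_smul_one, map_smul, smul_eq_mul]
    exact hu.hasDerivAt.mul_const _
  have h : ∃ d : SuperAlg N, ∀ l : SuperAlg N →ₗ[ℝ] ℝ,
      HasDerivAt (fun y => l (algebraMap ℝ (SuperAlg N) (u y))) (l d) x := ⟨_, key⟩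
  unfold derLam
  rw [dif_pos h]
  rw [← sub_eq_zero, ← Module.forall_dual_apply_eq_zero_iff ℝ]
  intro l
  rw [map_sub, sub_eq_zero]
  exact (h.choose_spec l).unique (key l)

theorem derLam_zero' {N : ℕ} (x : ℝ) :
    derLam (fun _ => (0 : SuperAlg N)) x = 0 := by
  have := derLam_algMap (N := N) (fun _ => 0) x (differentiableAt_const _)
  simpa using this

theorem pdxR_smooth (u : ℝ → ℝ → ℝ)
    (hu : ContDiff ℝ (⊤ : ℕ∞) (fun p : ℝ × ℝ => u p.1 p.2)) :
    ContDiff ℝ (⊤ : ℕ∞) (fun p : ℝ × ℝ => pdxR u p.1 p.2) := by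
  have e : (fun p : ℝ × ℝ => pdxR u p.1 p.2)
      = fun p : ℝ × ℝ => fderiv ℝ (fun p : ℝ × ℝ => u p.1 p.2) p (1, 0) := by
    funext p
    have h1 : HasFDerivAt (fun p : ℝ × ℝ => u p.1 p.2) _ (p.1, p.2) :=
      (hu.differentiable (by simp) p).hasFDerivAt
    have h2 : HasDerivAt (fun y : ℝ => (y, p.2)) ((1 : ℝ), (0 : ℝ)) p.1 :=
      (hasDerivAt_id _).prodMk (hasDerivAt_const _ _)
    exact (h1.comp_hasDerivAt p.1 h2).deriv
  rw [e]
  exact (hu.fderiv_right (m := (⊤ : ℕ∞)) (by simp)).clm_apply contDiff_const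

theorem pdxR_iter_smooth (u : ℝ → ℝ → ℝ)
    (hu : ContDiff ℝ (⊤ : ℕ∞) (fun p : ℝ × ℝ => u p.1 p.2)) (m : ℕ) :
    ContDiff ℝ (⊤ : ℕ∞) (fun p : ℝ × ℝ => (pdxR^[m] u) p.1 p.2) := by
  induction m with
  | zero => simpa using hu
  | succ m ih => rw [Function.iterate_succ_apply']; exact pdxR_smooth _ ih

theorem derLam_pdxR {N : ℕ} (u : ℝ → ℝ → ℝ)
    (hu : ContDiff ℝ (⊤ : ℕ∞) (fun p : ℝ × ℝ => u p.1 p.2)) (x t : ℝ) :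
    derLam (fun y => algebraMap ℝ (SuperAlg N) (u y t)) x
      = algebraMap ℝ (SuperAlg N) (pdxR u x t) := by
  apply derLam_algMap (fun y => u y t)
  have h2 : ContDiff ℝ (⊤ : ℕ∞) (fun y : ℝ => (y, t)) := contDiff_id.prodMk contDiff_const
  exact (hu.comp h2).differentiable (by simp) x

/-- `(u, 0)` -/
def bosE (N : ℕ) (u : ℝ → ℝ → ℝ) : SF N := ⟨fun x t => algebraMap ℝ (SuperAlg N) (u x t), 0⟩
/-- `(0, u)` -/
def bosO (N : ℕ) (u : ℝ → ℝ → ℝ) : SF N := ⟨0, fun x t => algebraMap ℝ (SuperAlg N) (u x t)⟩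

section
variable {N : ℕ} (u : ℝ → ℝ → ℝ)
    (hu : ContDiff ℝ (⊤ : ℕ∞) (fun p : ℝ × ℝ => u p.1 p.2))

theorem dsd_dsd (g : SF N) : g.Dsd.Dsd = g.dx := rfl

theorem dpow_two_mul (m : ℕ) (g : SF N) : Dpow (2 * m) g = Xpow m g := by
  induction m with
  | zero => rfl
  | succ m ih =>
    show (Dpow (2 * m) g).Dsd.Dsd = (Xpow m g).dx
    rw [ih, dsd_dsd]

theorem dx_bosE (u : ℝ → ℝ → ℝ)
    (hu : ContDiff ℝ (⊤ : ℕ∞) (fun p : ℝ × ℝ => u p.1 p.2)) :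
    (bosE N u).dx = bosE N (pdxR u) := by
  refine SF.ext ?_ ?_
  · funext x t; exact derLam_pdxR u hu x t
  · funext x t; exact derLam_zero' x

theorem dx_bosO (u : ℝ → ℝ → ℝ)
    (hu : ContDiff ℝ (⊤ : ℕ∞) (fun p : ℝ × ℝ => u p.1 p.2)) :
    (bosO N u).dx = bosO N (pdxR u) := by
  refine SF.ext ?_ ?_
  · funext x t; exact derLam_zero' x
  · funext x t; exact derLam_pdxR u hu x t

theorem xpow_bosE (u : ℝ → ℝ → ℝ)
    (hu : ContDiff ℝ (⊤ : ℕ∞) (fun p : ℝ × ℝ => u p.1 p.2)) (m : ℕ) :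
    Xpow m (bosE N u) = bosE N (pdxR^[m] u) := by
  induction m with
  | zero => rfl
  | succ m ih =>
    rw [Function.iterate_succ_apply', ← dx_bosE _ (pdxR_iter_smooth u hu m), ← ih]; rfl

theorem xpow_bosO (u : ℝ → ℝ → ℝ)
    (hu : ContDiff ℝ (⊤ : ℕ∞) (fun p : ℝ × ℝ => u p.1 p.2)) (m : ℕ) :
    Xpow m (bosO N u) = bosO N (pdxR^[m] u) := by
  induction m with
  | zero => rfl
  | succ m ih =>
    rw [Function.iterate_succ_apply', ← dx_bosO _ (pdxR_iter_smooth u hu m), ← ih]; rfl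

theorem bosE_mul_bosE (u v : ℝ → ℝ → ℝ) :
    bosE N u * bosE N v = bosE N (fun x t => u x t * v x t) := by
  refine SF.ext ?_ ?_
  · funext x t
    exact (map_mul (algebraMap ℝ (SuperAlg N)) _ _).symm
  · funext x t
    show (0 : SuperAlg N) * _ + _ * (0 : SuperAlg N) = 0
    simp

theorem bosE_mul_bosO (u v : ℝ → ℝ → ℝ) :
    bosE N u * bosO N v = bosO N (fun x t => u x t * v x t) := by
  refine SF.ext ?_ ?_
  · funext x t
    exact mul_zero _
  · funext x t
    show (0 : SuperAlg N) * _ +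
      CliffordAlgebra.involute (algebraMap ℝ (SuperAlg N) (u x t)) *
        algebraMap ℝ (SuperAlg N) (v x t) = algebraMap ℝ (SuperAlg N) (u x t * v x t)
    rw [AlgHom.commutes, map_mul, zero_mul, zero_add]

theorem sf_zero_mul (g : SF N) : 0 * g = 0 := by
  refine SF.ext ?_ ?_
  · funext x t
    exact zero_mul _
  · funext x t
    show (0 : SuperAlg N) * _ + CliffordAlgebra.involute (0 : SuperAlg N) * _ = 0
    rw [map_zero, zero_mul, zero_mul, zero_add]

/-- additive version of `bosE` -/
def bosEHom (N : ℕ) : (ℝ → ℝ → ℝ) →+ SF N where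
  toFun := bosE N
  map_zero' := SF.ext (by funext x t; exact map_zero (algebraMap ℝ (SuperAlg N))) rfl
  map_add' u v := SF.ext (by funext x t; exact map_add (algebraMap ℝ (SuperAlg N)) _ _)
    (by funext x t; exact (add_zero (0 : SuperAlg N)).symm)

/-- additive version of `bosO` -/
def bosOHom (N : ℕ) : (ℝ → ℝ → ℝ) →+ SF N where
  toFun := bosO N
  map_zero' := SF.ext rfl (by funext x t; exact map_zero (algebraMap ℝ (SuperAlg N)))
  map_add' u v := SF.ext (by funext x t; exact (add_zero (0 : SuperAlg N)).symm)
    (by funext x t; exact map_add (algebraMap ℝ (SuperAlg N)) _ _)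

theorem sum_even_odd {M : Type*} [AddCommMonoid M] (k : ℕ) (F : ℕ → M) :
    ∑ i : Fin (2 * k), F i.1 = ∑ m : Fin k, (F (2 * m.1) + F (2 * m.1 + 1)) := by
  rw [Fin.sum_univ_eq_sum_range F, Fin.sum_univ_eq_sum_range (fun m => F (2 * m) + F (2 * m + 1))]
  induction k with
  | zero => rfl
  | succ k ih =>
    rw [Finset.sum_range_succ, ← ih, show 2 * (k + 1) = 2 * k + 1 + 1 by ring,
      Finset.sum_range_succ, Finset.sum_range_succ, add_assoc]
end

/-- reduction to KdV.  If `θ_{2j} = f_j`, `θ_{2j+1} = ϑ f_j` for real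
functions `f_j` and real functions `A_m` solve `Σ_m A_m ∂ₓ^m f_j = −∂ₓ^k f_j`, then
`a_{2m} = A_m`, `a_{2m+1} = 0` solve the kernel system. -/
theorem statement_13 {N : ℕ} (hN : 1 ≤ N) (k : ℕ) (hk : 1 ≤ k)
    (f A : Fin k → ℝ → ℝ → ℝ)
    (hf : ∀ j : Fin k, ContDiff ℝ (⊤ : ℕ∞) (fun p : ℝ × ℝ => f j p.1 p.2))
    (hA : ∀ m : Fin k, ContDiff ℝ (⊤ : ℕ∞) (fun p : ℝ × ℝ => A m p.1 p.2))
    (θ : ℕ → SF N)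
    (hθe : ∀ j : Fin k, θ (2*j.1)
      = ⟨fun x t => algebraMap ℝ (SuperAlg N) (f j x t), 0⟩)
    (hθo : ∀ j : Fin k, θ (2*j.1+1)
      = ⟨0, fun x t => algebraMap ℝ (SuperAlg N) (f j x t)⟩)
    (a : ℕ → SF N)
    (hae : ∀ m : Fin k, a (2*m.1)
      = ⟨fun x t => algebraMap ℝ (SuperAlg N) (A m x t), 0⟩)
    (hao : ∀ m : Fin k, a (2*m.1+1) = 0)
    (hlin : ∀ j : Fin k, ∀ x t : ℝ,
      ∑ m : Fin k, A m x t * (pdxR^[m.1] (f j)) x t = -((pdxR^[k] (f j)) x t)) :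
    ∀ j < 2*k, Xpow k (θ j) + ∑ i : Fin (2*k), a i.1 * Dpow i.1 (θ j) = 0 := by
  intro j hj
  rw [sum_even_odd k (fun i => a i * Dpow i (θ j))]
  have red : ∑ m : Fin k, (a (2 * m.1) * Dpow (2 * m.1) (θ j)
        + a (2 * m.1 + 1) * Dpow (2 * m.1 + 1) (θ j))
      = ∑ m : Fin k, bosE N (A m) * Xpow m.1 (θ j) := by
    refine Finset.sum_congr rfl fun m _ => ?_
    rw [hao m, hae m, sf_zero_mul, add_zero, dpow_two_mul]
    rfl
  rw [red]
  have hz : ∀ j : Fin k, (pdxR^[k] (f j)) + ∑ m : Fin k,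
      (fun x t => A m x t * (pdxR^[m.1] (f j)) x t) = 0 := by
    intro j
    funext x t
    simp only [Pi.add_apply, Finset.sum_apply, Pi.zero_apply]
    rw [hlin j x t]; ring
  obtain ⟨i, hi | hi⟩ := Nat.even_or_odd' j
  · have hik : i < k := by omega
    have e : θ j = bosE N (f ⟨i, hik⟩) := by rw [hi]; exact hθe ⟨i, hik⟩
    rw [e, xpow_bosE _ (hf _)]
    simp only [xpow_bosE _ (hf ⟨i, hik⟩), bosE_mul_bosE]
    have := congrArg (bosEHom N) (hz ⟨i, hik⟩)
    rw [map_add, map_sum, map_zero] at this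
    exact this
  · have hik : i < k := by omega
    have e : θ j = bosO N (f ⟨i, hik⟩) := by rw [hi]; exact hθo ⟨i, hik⟩
    rw [e, xpow_bosO _ (hf _)]
    simp only [xpow_bosO _ (hf ⟨i, hik⟩), bosE_mul_bosO]
    have := congrArg (bosOHom N) (hz ⟨i, hik⟩)
    rw [map_add, map_sum, map_zero] at this
    exact this
end
end

section
/- Let u, θ : ℝ² → ℝ be smooth with θ nowhere vanishing, and let λ ∈ ℝ. Suppose u solves the KdV equation and θ solves the associated linear system at λ. Then û := u + 2∂ₓ(∂ₓθ/θ) also solves the KdV equation. -/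
noncomputable section

/-- The partial derivative in `t` of a function of `(x,t)`. -/
def pdtR (u : ℝ → ℝ → ℝ) : ℝ → ℝ → ℝ := fun x t => deriv (fun s => u x s) t

/-- The KdV equation `∂ₜu = (1/4)(∂ₓ³u + 6u∂ₓu)`. -/
def KdVR (u : ℝ → ℝ → ℝ) : Prop :=
  ∀ x t, pdtR u x t = (1/4) * (pdxR (pdxR (pdxR u)) x t + 6 * u x t * pdxR u x t)

/-- The linear system associated with `u` at `λ`:
`∂ₓ²θ + uθ = λθ` and `∂ₜθ = λ∂ₓθ + (1/2)u∂ₓθ − (1/4)(∂ₓu)θ`. -/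
def KdVLin (u θ : ℝ → ℝ → ℝ) (lam : ℝ) : Prop :=
  (∀ x t, pdxR (pdxR θ) x t + u x t * θ x t = lam * θ x t) ∧
  (∀ x t, pdtR θ x t = lam * pdxR θ x t + (1/2) * (u x t * pdxR θ x t)
      - (1/4) * (pdxR u x t * θ x t))

def SmR (u : ℝ → ℝ → ℝ) : Prop := ContDiff ℝ (⊤ : ℕ∞) (fun p : ℝ × ℝ => u p.1 p.2)

lemma SmR.x_has {u : ℝ → ℝ → ℝ} (h : SmR u) (x t : ℝ) :
    HasDerivAt (fun y => u y t) (fderiv ℝ (fun p : ℝ × ℝ => u p.1 p.2) (x, t) (1, 0)) x := by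
  have h1 : HasFDerivAt (fun p : ℝ × ℝ => u p.1 p.2) _ (x, t) :=
    ((ContDiff.differentiable h (by simp)) (x, t)).hasFDerivAt
  have h2 : HasDerivAt (fun y : ℝ => (y, t)) ((1 : ℝ), (0 : ℝ)) x :=
    (hasDerivAt_id x).prodMk (hasDerivAt_const x t)
  exact HasFDerivAt.comp_hasDerivAt x h1 h2

lemma SmR.t_has {u : ℝ → ℝ → ℝ} (h : SmR u) (x t : ℝ) :
    HasDerivAt (fun s => u x s) (fderiv ℝ (fun p : ℝ × ℝ => u p.1 p.2) (x, t) (0, 1)) t := by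
  have h1 : HasFDerivAt (fun p : ℝ × ℝ => u p.1 p.2) _ (x, t) :=
    ((ContDiff.differentiable h (by simp)) (x, t)).hasFDerivAt
  have h2 : HasDerivAt (fun y : ℝ => (x, y)) ((0 : ℝ), (1 : ℝ)) t :=
    (hasDerivAt_const t x).prodMk (hasDerivAt_id t)
  exact HasFDerivAt.comp_hasDerivAt t h1 h2

lemma SmR.hx {u : ℝ → ℝ → ℝ} (h : SmR u) (x t : ℝ) :
    HasDerivAt (fun y => u y t) (pdxR u x t) x :=
  (h.x_has x t).differentiableAt.hasDerivAt

lemma SmR.ht {u : ℝ → ℝ → ℝ} (h : SmR u) (x t : ℝ) :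
    HasDerivAt (fun s => u x s) (pdtR u x t) t :=
  (h.t_has x t).differentiableAt.hasDerivAt

lemma SmR.pdx_eq {u : ℝ → ℝ → ℝ} (h : SmR u) :
    (fun p : ℝ × ℝ => pdxR u p.1 p.2) =
      fun p => fderiv ℝ (fun p : ℝ × ℝ => u p.1 p.2) p (1, 0) := by
  funext p; exact (h.x_has p.1 p.2).deriv

lemma SmR.pdt_eq {u : ℝ → ℝ → ℝ} (h : SmR u) :
    (fun p : ℝ × ℝ => pdtR u p.1 p.2) =
      fun p => fderiv ℝ (fun p : ℝ × ℝ => u p.1 p.2) p (0, 1) := by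
  funext p; exact (h.t_has p.1 p.2).deriv

lemma SmR.fd {u : ℝ → ℝ → ℝ} (h : SmR u) :
    ContDiff ℝ (⊤ : ℕ∞) (fderiv ℝ (fun p : ℝ × ℝ => u p.1 p.2)) :=
  ContDiff.fderiv_right (m := (⊤ : ℕ∞)) h (by simp)

lemma SmR.pdx {u : ℝ → ℝ → ℝ} (h : SmR u) : SmR (pdxR u) := by
  unfold SmR; rw [h.pdx_eq]; exact h.fd.clm_apply contDiff_const

lemma SmR.pdt {u : ℝ → ℝ → ℝ} (h : SmR u) : SmR (pdtR u) := by
  unfold SmR; rw [h.pdt_eq]; exact h.fd.clm_apply contDiff_const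

lemma SmR.comm {u : ℝ → ℝ → ℝ} (h : SmR u) (x t : ℝ) :
    pdtR (pdxR u) x t = pdxR (pdtR u) x t := by
  have hd : DifferentiableAt ℝ (fderiv ℝ (fun p : ℝ × ℝ => u p.1 p.2)) (x, t) :=
    (h.fd.differentiable (by simp)) _
  have a : pdtR (pdxR u) x t = _ := (h.pdx.t_has x t).deriv
  have b : pdxR (pdtR u) x t = _ := (h.pdt.x_has x t).deriv
  rw [a, b, h.pdx_eq, h.pdt_eq, fderiv_clm_apply hd (differentiableAt_const _),
    fderiv_clm_apply hd (differentiableAt_const _)]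
  have hs : IsSymmSndFDerivAt ℝ (fun p : ℝ × ℝ => u p.1 p.2) (x, t) :=
    (ContDiff.contDiffAt h).isSymmSndFDerivAt (by
      simp only [minSmoothness_of_isRCLikeNormedField]; exact WithTop.coe_le_coe.2 (le_top : (2 : ℕ∞) ≤ ⊤))
  simpa using hs.eq (0, 1) (1, 0)

lemma pdxR_of {u v : ℝ → ℝ → ℝ} (h : ∀ x t, HasDerivAt (fun y => u y t) (v x t) x) :
    pdxR u = v := by
  funext x t; exact (h x t).deriv

/-- the Darboux transformation for KdV:
`û = u + 2∂ₓ(∂ₓθ/θ)` again solves KdV. -/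
theorem statement_14 (u θ : ℝ → ℝ → ℝ) (lam : ℝ)
    (hu : ContDiff ℝ (⊤ : ℕ∞) (fun p : ℝ × ℝ => u p.1 p.2))
    (hθ : ContDiff ℝ (⊤ : ℕ∞) (fun p : ℝ × ℝ => θ p.1 p.2))
    (hθ0 : ∀ x t, θ x t ≠ 0)
    (hK : KdVR u) (hL : KdVLin u θ lam) :
    KdVR (fun x t => u x t + 2 * pdxR (fun y s => pdxR θ y s / θ y s) x t) := by
  obtain ⟨hL1, hL2⟩ := hL
  have su : SmR u := hu
  have sθ : SmR θ := hθ
  have su1 := su.pdx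
  have su2 := su1.pdx
  obtain ⟨w, hw⟩ : ∃ w : ℝ → ℝ → ℝ, w = fun y s => pdxR θ y s / θ y s := ⟨_, rfl⟩
  have hwx : ∀ x t, HasDerivAt (fun y => w y t) (lam - u x t - w x t ^ 2) x := by
    intro x t
    have h := (sθ.pdx.hx x t).div (sθ.hx x t) (hθ0 x t)
    have e : pdxR (pdxR θ) x t = lam * θ x t - u x t * θ x t := by linarith [hL1 x t]
    have h0 := hθ0 x t
    rw [hw]
    refine h.congr_deriv ?_
    rw [e]
    field_simp
  have hwt : ∀ x t, HasDerivAt (fun s => w x s)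
      (pdxR u x t / 2 * w x t + (lam + u x t / 2) * (lam - u x t - w x t ^ 2)
        - pdxR (pdxR u) x t / 4) t := by
    intro x t
    have h := (sθ.pdx.ht x t).div (sθ.ht x t) (hθ0 x t)
    have e : pdxR (pdxR θ) x t = lam * θ x t - u x t * θ x t := by linarith [hL1 x t]
    have h0 := hθ0 x t
    have hm : pdtR θ = fun x t => lam * pdxR θ x t + (1/2) * (u x t * pdxR θ x t)
      - (1/4) * (pdxR u x t * θ x t) := by funext x t; exact hL2 x t
    have hc' : pdxR (fun x t => lam * pdxR θ x t + (1/2) * (u x t * pdxR θ x t)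
      - (1/4) * (pdxR u x t * θ x t)) x t = _ :=
      ((((sθ.pdx.hx x t).const_mul lam).add
        (((su.hx x t).mul (sθ.pdx.hx x t)).const_mul (1/2))).sub
        (((su1.hx x t).mul (sθ.hx x t)).const_mul (1/4))).deriv
    have hc := sθ.comm x t
    rw [hm, hc'] at hc
    rw [hw]
    refine h.congr_deriv ?_
    rw [hc, hL2, e]
    field_simp
    ring
  have hv : (fun x t => u x t + 2 * pdxR (fun y s => pdxR θ y s / θ y s) x t)
      = fun x t => 2 * lam - u x t - 2 * w x t ^ 2 := by
    rw [← hw, pdxR_of hwx]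
    funext x t; ring
  rw [hv]
  have d1 : pdxR (fun x t => 2 * lam - u x t - 2 * w x t ^ 2) =
      fun x t => - pdxR u x t - 4 * w x t * (lam - u x t - w x t ^ 2) := by
    apply pdxR_of; intro x t
    refine (((su.hx x t).const_sub (2 * lam)).sub (((hwx x t).pow 2).const_mul 2)).congr_deriv ?_
    push_cast; ring
  have d2 : pdxR (fun x t => - pdxR u x t - 4 * w x t * (lam - u x t - w x t ^ 2)) =
      fun x t => - pdxR (pdxR u) x t - 4 * (lam - u x t - w x t ^ 2) ^ 2
        + 4 * w x t * pdxR u x t + 8 * w x t ^ 2 * (lam - u x t - w x t ^ 2) := by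
    apply pdxR_of; intro x t
    refine ((su1.hx x t).neg.sub (((hwx x t).const_mul 4).mul
      (((su.hx x t).const_sub lam).sub ((hwx x t).pow 2)))).congr_deriv ?_
    simp; ring
  have d3 : ∀ x t, pdxR (fun x t => - pdxR (pdxR u) x t - 4 * (lam - u x t - w x t ^ 2) ^ 2
        + 4 * w x t * pdxR u x t + 8 * w x t ^ 2 * (lam - u x t - w x t ^ 2)) x t = _ :=
    fun x t => ((((su2.hx x t).neg.sub
      (((((su.hx x t).const_sub lam).sub ((hwx x t).pow 2)).pow 2).const_mul 4)).add
      (((hwx x t).const_mul 4).mul (su1.hx x t))).add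
      ((((hwx x t).pow 2).const_mul 8).mul
      (((su.hx x t).const_sub lam).sub ((hwx x t).pow 2)))).deriv
  intro x t
  have dt : pdtR (fun x t => 2 * lam - u x t - 2 * w x t ^ 2) x t = _ :=
    (((su.ht x t).const_sub (2 * lam)).sub (((hwt x t).pow 2).const_mul 2)).deriv
  rw [d1, d2, d3, dt, hK x t]
  simp
  ring
end
end
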